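/- Corollary 2 (upper bound): Let N ≥ 4 and let |ψ⟩ be an N-qubit pure state on qubits A, B, C₁, C₂, …, C_{N−2}. Then C²(|ψ⟩_{ABC₁|C₂…C_{N−2}}) ≤ 2·C_a²(ρ_{AB}) + Σ_{i=1}^{N−2} ( C_a²(ρ_{AC_i}) + C_a²(ρ_{BC_i}) ) + Σ_{j∈J} C_a²(ρ_{C₁ j}), where J = {A, B, C₂, …, C_{N−2}} and the ρ's are the two-qubit reduced density matrices of |ψ⟩⟨ψ|. -/

import Mathlib

open scoped BigOperators

noncomputable section

/-- Partial trace over the second tensor factor: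
`(ptraceRight ρ) s s' = ∑ t, ρ (s,t) (s',t)`. -/
def ptraceRight {S T : Type*} [Fintype S] [Fintype T]
    (ρ : Matrix (S × T) (S × T) ℂ) : Matrix S S ℂ :=
  fun s s' => ∑ t : T, ρ (s, t) (s', t)

/-- Partial trace over the first tensor factor. -/
def ptraceLeft {S T : Type*} [Fintype S] [Fintype T]
    (ρ : Matrix (S × T) (S × T) ℂ) : Matrix T T ℂ :=
  fun t t' => ∑ s : S, ρ (s, t) (s, t')

/-- The density matrix `|ψ⟩⟨ψ|` of a (pure) state vector `ψ`. -/
def pureDM {d : Type*} (ψ : d → ℂ) : Matrix d d ℂ :=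
  fun x y => ψ x * (starRingEnd ℂ) (ψ y)

/-- `Tr(ρ²)` (real part) of a square matrix. -/
def trSq {S : Type*} [Fintype S] (ρ : Matrix S S ℂ) : ℝ :=
  ((ρ * ρ).trace).re

/-- Linear entropy `T(ρ) = 1 - Tr(ρ²)`. -/
def linEnt {S : Type*} [Fintype S] (ρ : Matrix S S ℂ) : ℝ :=
  1 - trSq ρ

/-- Concurrence of a bipartite pure state `ψ : S × T → ℂ` (with respect to the
bipartition `S | T`): `C(ψ) = √(2 (1 - Tr ρ_S²))`. -/
def pureConc {S T : Type*} [Fintype S] [Fintype T] (ψ : S × T → ℂ) : ℝ :=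
  Real.sqrt (2 * (1 - trSq (ptraceRight (pureDM ψ))))

/-- The set of average pure-state concurrences over all finite pure-state
ensembles realizing the bipartite density matrix `ρ`. -/
def concSet {S T : Type*} [Fintype S] [Fintype T]
    (ρ : Matrix (S × T) (S × T) ℂ) : Set ℝ :=
  { c | ∃ (n : ℕ) (p : Fin n → ℝ) (φ : Fin n → S × T → ℂ),
      (∀ i, 0 ≤ p i) ∧ (∑ i, p i = 1) ∧
      (∀ i, ∑ x, ‖φ i x‖ ^ 2 = 1) ∧
      (ρ = ∑ i, (p i : ℂ) • pureDM (φ i)) ∧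
      c = ∑ i, p i * pureConc (φ i) }

/-- Concurrence of a bipartite mixed state (convex-roof extension). -/
def conc {S T : Type*} [Fintype S] [Fintype T]
    (ρ : Matrix (S × T) (S × T) ℂ) : ℝ :=
  sInf (concSet ρ)

/-- Concurrence of assistance of a bipartite mixed state. -/
def concA {S T : Type*} [Fintype S] [Fintype T]
    (ρ : Matrix (S × T) (S × T) ℂ) : ℝ :=
  sSup (concSet ρ)

/-- Concurrence of an `N`-qubit pure state `ψ` across the cut given by the
predicate `P` (the qubits satisfying `P` versus the rest). -/
def qubitCut {N : ℕ} (P : Fin N → Prop) [DecidablePred P]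
    (ψ : (Fin N → Fin 2) → ℂ) : ℝ :=
  pureConc (fun x : ({i // P i} → Fin 2) × ({i // ¬ P i} → Fin 2) =>
    ψ ((Equiv.piEquivPiSubtypeProd P (fun _ => Fin 2)).symm x))

/-- Assemble a full `N`-qubit configuration from values `x` at qubit `u`,
`y` at qubit `v`, and `f` elsewhere. -/
def assemble2 {N : ℕ} (u v : Fin N) (x y : Fin 2)
    (f : {i : Fin N // i ≠ u ∧ i ≠ v} → Fin 2) : Fin N → Fin 2 :=
  fun i => if h : i = u then x else if h' : i = v then y else f ⟨i, h, h'⟩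

/-- The two-qubit reduced density matrix of the `N`-qubit pure state `ψ` on the
(ordered) pair of qubits `u, v`, obtained by tracing out all other qubits. -/
def rdm2 {N : ℕ} (u v : Fin N) (ψ : (Fin N → Fin 2) → ℂ) :
    Matrix (Fin 2 × Fin 2) (Fin 2 × Fin 2) ℂ :=
  fun x y => ∑ f : {i : Fin N // i ≠ u ∧ i ≠ v} → Fin 2,
    ψ (assemble2 u v x.1 x.2 f) * (starRingEnd ℂ) (ψ (assemble2 u v y.1 y.2 f))

/-- The reduced density matrix of the `N`-qubit pure state `ψ` obtained by
tracing out the single qubit `v`, organized as a bipartite state on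
qubit `u` versus all remaining qubits. -/
def rdm1Rest {N : ℕ} (u v : Fin N) (ψ : (Fin N → Fin 2) → ℂ) :
    Matrix (Fin 2 × ({i : Fin N // i ≠ u ∧ i ≠ v} → Fin 2))
           (Fin 2 × ({i : Fin N // i ≠ u ∧ i ≠ v} → Fin 2)) ℂ :=
  fun x y => ∑ t : Fin 2,
    ψ (assemble2 u v x.1 t x.2) * (starRingEnd ℂ) (ψ (assemble2 u v y.1 t y.2))

/-- The linear entropy of a pure state as a sum of squared `2 × 2` minors. -/
theorem two_mul_one_sub_trSq {S T : Type*} [Fintype S] [Fintype T] (ψ : S × T → ℂ)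
    (hψ : ∑ x, ‖ψ x‖ ^ 2 = 1) :
    2 * (1 - trSq (ptraceRight (pureDM ψ))) =
      ∑ p : (S × T) × (S × T),
        ‖ψ p.1 * ψ p.2 - ψ (p.1.1, p.2.2) * ψ (p.2.1, p.1.2)‖ ^ 2 := by
  have h1 : ∑ p : (S × T) × (S × T), ‖ψ p.1 * ψ p.2‖ ^ 2 = 1 := by
    simp only [norm_mul, mul_pow, Fintype.sum_prod_type (α₁ := S × T) (α₂ := S × T)]
    rw [← Finset.sum_mul_sum, hψ, one_mul]
  let e : ((S × T) × (S × T)) ≃ ((S × T) × (S × T)) :=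
    ⟨fun p => ((p.1.1, p.2.2), (p.2.1, p.1.2)), fun p => ((p.1.1, p.2.2), (p.2.1, p.1.2)),
      fun _ => rfl, fun _ => rfl⟩
  have h2 : ∑ p : (S × T) × (S × T), ‖ψ (p.1.1, p.2.2) * ψ (p.2.1, p.1.2)‖ ^ 2 = 1 := by
    rw [← h1]
    exact Equiv.sum_comp e (fun p => ‖ψ p.1 * ψ p.2‖ ^ 2)
  have h3 : trSq (ptraceRight (pureDM ψ)) =
      ∑ p : (S × T) × (S × T),
        (ψ p.1 * ψ p.2 * (starRingEnd ℂ) (ψ (p.1.1, p.2.2) * ψ (p.2.1, p.1.2))).re := by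
    simp only [trSq, Matrix.trace, Matrix.diag, Matrix.mul_apply, ptraceRight, pureDM,
      Finset.sum_mul_sum, Fintype.sum_prod_type, Complex.re_sum]
    refine Finset.sum_congr rfl fun s _ => ?_
    rw [Finset.sum_comm]
    refine Finset.sum_congr rfl fun t _ => Finset.sum_congr rfl fun s' _ =>
      Finset.sum_congr rfl fun t' _ => ?_
    rw [map_mul]
    congr 1
    ring
  have key : ∀ z w : ℂ, ‖z - w‖ ^ 2 = ‖z‖ ^ 2 + ‖w‖ ^ 2 - 2 * (z * (starRingEnd ℂ) w).re := by
    intro z w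
    simp only [Complex.sq_norm, Complex.normSq_sub]
  simp only [key, Finset.sum_sub_distrib, Finset.sum_add_distrib, h1, h2, h3, ← Finset.mul_sum]
  ring

/-- The polarized two-qubit concurrence form. -/
def spinFlipForm (φ χ : Fin 2 × Fin 2 → ℂ) : ℂ :=
  φ (0, 0) * χ (1, 1) + φ (1, 1) * χ (0, 0) - φ (0, 1) * χ (1, 0) - φ (1, 0) * χ (0, 1)

theorem spinFlipForm_comm (φ χ : Fin 2 × Fin 2 → ℂ) :
    spinFlipForm φ χ = spinFlipForm χ φ := by
  unfold spinFlipForm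
  ring

theorem pureConc_eq_norm_spinFlipForm (φ : Fin 2 × Fin 2 → ℂ) (hφ : ∑ x, ‖φ x‖ ^ 2 = 1) :
    pureConc φ = ‖spinFlipForm φ φ‖ := by
  rw [pureConc, two_mul_one_sub_trSq φ hφ, Real.sqrt_eq_iff_eq_sq (by positivity) (norm_nonneg _)]
  have h1 : spinFlipForm φ φ = 2 * (φ (0, 0) * φ (1, 1) - φ (0, 1) * φ (1, 0)) := by
    unfold spinFlipForm
    ring
  have h2 : ∀ z : ℂ, ‖z‖ ^ 2 = z.re ^ 2 + z.im ^ 2 := fun z => by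
    rw [Complex.sq_norm, Complex.normSq_apply]; ring
  rw [h1]
  simp only [Fintype.sum_prod_type, Fin.sum_univ_two, h2, Complex.sub_re, Complex.sub_im,
    Complex.mul_re, Complex.mul_im, Complex.re_ofNat, Complex.im_ofNat]
  ring

theorem norm_spinFlipForm_self_le (φ : Fin 2 × Fin 2 → ℂ) :
    ‖spinFlipForm φ φ‖ ≤ ∑ x, ‖φ x‖ ^ 2 := by
  have h1 : spinFlipForm φ φ = 2 * (φ (0, 0) * φ (1, 1)) - 2 * (φ (0, 1) * φ (1, 0)) := by
    unfold spinFlipForm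
    ring
  have h2 := norm_sub_le (2 * (φ (0, 0) * φ (1, 1))) (2 * (φ (0, 1) * φ (1, 0)))
  rw [h1]
  simp only [norm_mul, Complex.norm_ofNat, Fintype.sum_prod_type, Fin.sum_univ_two] at h2 ⊢
  nlinarith [sq_nonneg (‖φ (0, 0)‖ - ‖φ (1, 1)‖), sq_nonneg (‖φ (0, 1)‖ - ‖φ (1, 0)‖)]

theorem bddAbove_concSet (ρ : Matrix (Fin 2 × Fin 2) (Fin 2 × Fin 2) ℂ) :
    BddAbove (concSet ρ) := by
  refine ⟨1, ?_⟩
  rintro c ⟨n, p, φ, hp, hp1, hφ, -, rfl⟩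
  rw [← hp1]
  refine Finset.sum_le_sum fun i _ => mul_le_of_le_one_right (hp i) ?_
  rw [pureConc_eq_norm_spinFlipForm _ (hφ i), ← hφ i]
  exact norm_spinFlipForm_self_le _

theorem exists_eq_smul_unit (φ : Fin 2 × Fin 2 → ℂ) :
    ∃ (r : ℝ) (χ : Fin 2 × Fin 2 → ℂ), ∑ x, ‖χ x‖ ^ 2 = 1 ∧ φ = (r : ℂ) • χ := by
  by_cases h : ∑ x, ‖φ x‖ ^ 2 = 0
  · refine ⟨0, Pi.single (0, 0) 1, by simp [Fintype.sum_prod_type, Pi.single_apply], ?_⟩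
    rw [Finset.sum_eq_zero_iff_of_nonneg (fun _ _ => by positivity)] at h
    ext x
    simpa using h x (Finset.mem_univ x)
  · have hpos : 0 ≤ ∑ x, ‖φ x‖ ^ 2 := Finset.sum_nonneg fun _ _ => by positivity
    set r := √(∑ x, ‖φ x‖ ^ 2)
    have hr2 : r ^ 2 = ∑ x, ‖φ x‖ ^ 2 := Real.sq_sqrt hpos
    have hr0 : r ≠ 0 := fun h0 => h (by rw [← hr2, h0]; simp)
    refine ⟨r, (r⁻¹ : ℂ) • φ, ?_, ?_⟩
    · simp only [Pi.smul_apply, smul_eq_mul, norm_mul, mul_pow, ← Finset.mul_sum, ← hr2,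
        norm_inv, Complex.norm_real, Real.norm_eq_abs, inv_pow, sq_abs]
      field_simp
    · rw [smul_smul, mul_inv_cancel₀ (by exact_mod_cast hr0), one_smul]

/-- Every (unnormalized) pure-state decomposition bounds the concurrence of assistance. -/
theorem sum_norm_spinFlipForm_le_concA {ι : Type*} [Fintype ι] (φ : ι → Fin 2 × Fin 2 → ℂ)
    (hφ : ∑ i, ∑ x, ‖φ i x‖ ^ 2 = 1) :
    ∑ i, ‖spinFlipForm (φ i) (φ i)‖ ≤ concA (∑ i, pureDM (φ i)) := by
  choose r χ hχ hr using fun i => exists_eq_smul_unit (φ i)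
  let e := Fintype.equivFin ι
  refine le_csSup (bddAbove_concSet _)
    ⟨Fintype.card ι, fun k => r (e.symm k) ^ 2, fun k => χ (e.symm k), fun _ => sq_nonneg _, ?_,
      fun k => hχ _, ?_, ?_⟩
  · rw [Equiv.sum_comp e.symm (fun i => r i ^ 2), ← hφ]
    refine Finset.sum_congr rfl fun i _ => ?_
    simp only [hr i, Pi.smul_apply, smul_eq_mul, norm_mul, mul_pow, ← Finset.mul_sum, hχ i,
      Complex.norm_real, Real.norm_eq_abs, sq_abs, mul_one]
  · rw [Equiv.sum_comp e.symm (fun i => ((r i ^ 2 : ℝ) : ℂ) • pureDM (χ i))]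
    refine Finset.sum_congr rfl fun i _ => ?_
    ext x y
    simp only [hr i, pureDM, Pi.smul_apply, Matrix.smul_apply, smul_eq_mul, map_mul,
      Complex.conj_ofReal, Complex.ofReal_pow]
    ring
  · rw [Equiv.sum_comp e.symm (fun i => r i ^ 2 * pureConc (χ i))]
    refine Finset.sum_congr rfl fun i _ => ?_
    have h : spinFlipForm (φ i) (φ i) = (r i : ℂ) ^ 2 * spinFlipForm (χ i) (χ i) := by
      simp only [hr i, spinFlipForm, Pi.smul_apply, smul_eq_mul]
      ring
    rw [pureConc_eq_norm_spinFlipForm _ (hχ i), h, norm_mul, norm_pow, Complex.norm_real,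
      Real.norm_eq_abs, sq_abs]

theorem exists_rotation_lt {p q r : ℝ} (h : r ^ 2 < p ^ 2 + q ^ 2) :
    ∃ c s : ℝ, c ^ 2 + s ^ 2 = 1 ∧ r < (c ^ 2 - s ^ 2) * p + 2 * c * s * q := by
  set w : ℂ := ⟨p, q⟩ with hw
  refine ⟨Real.cos (w.arg / 2), Real.sin (w.arg / 2), Real.cos_sq_add_sin_sq _, ?_⟩
  have hc : Real.cos (w.arg / 2) ^ 2 - Real.sin (w.arg / 2) ^ 2 = Real.cos w.arg := by
    rw [← Real.cos_two_mul']; ring_nf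
  have hs : 2 * Real.cos (w.arg / 2) * Real.sin (w.arg / 2) = Real.sin w.arg := by
    rw [mul_right_comm, ← Real.sin_two_mul]; ring_nf
  have hp : p = ‖w‖ * Real.cos w.arg := (Complex.norm_mul_cos_arg w).symm
  have hq : q = ‖w‖ * Real.sin w.arg := (Complex.norm_mul_sin_arg w).symm
  have hn : ‖w‖ ^ 2 = p ^ 2 + q ^ 2 := by
    rw [Complex.sq_norm, Complex.normSq_apply]; ring
  have hR : (Real.cos w.arg) * p + Real.sin w.arg * q = ‖w‖ := by
    nth_rewrite 1 [hp, hq]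
    linear_combination ‖w‖ * Real.cos_sq_add_sin_sq w.arg
  rw [hc, hs, hR]
  exact lt_of_pow_lt_pow_left₀ 2 (norm_nonneg _) (hn ▸ h)

/-- If the off-diagonal entry of a complex symmetric `2 × 2` matrix dominates, a unitary
congruence strictly increases the `ℓ¹` norm of the diagonal. -/
theorem exists_congruence_lt {a b d : ℂ} (h : ‖a‖ * ‖d‖ < ‖b‖ ^ 2) :
    ∃ (c s : ℝ) (z : ℂ), c ^ 2 + s ^ 2 = 1 ∧ ‖z‖ = 1 ∧
      ‖a‖ + ‖d‖ < ‖c ^ 2 * a + s ^ 2 * z ^ 2 * d + 2 * c * s * z * b‖ +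
        ‖s ^ 2 * a + c ^ 2 * z ^ 2 * d - 2 * c * s * z * b‖ := by
  set u : ℂ := Complex.exp (a.arg * Complex.I) with hu
  set z : ℂ := Complex.exp (((a.arg - d.arg) / 2 : ℝ) * Complex.I) with hz
  have hu1 : ‖u‖ = 1 := Complex.norm_exp_ofReal_mul_I _
  have hz1 : ‖z‖ = 1 := Complex.norm_exp_ofReal_mul_I _
  have hu0 : u ≠ 0 := Complex.exp_ne_zero _
  have ha : a = u * ‖a‖ := by rw [mul_comm, hu, Complex.norm_mul_exp_arg_mul_I]
  have hd : z ^ 2 * d = u * ‖d‖ := by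
    have h1 : d = Complex.exp (d.arg * Complex.I) * ‖d‖ := by
      rw [mul_comm, Complex.norm_mul_exp_arg_mul_I]
    nth_rewrite 1 [h1]
    rw [← mul_assoc, hz, hu, ← Complex.exp_nat_mul, ← Complex.exp_add]
    congr 2
    push_cast
    ring
  obtain ⟨β, hβ⟩ : ∃ β, z * b = u * β := ⟨u⁻¹ * (z * b), by field_simp⟩
  have hbn : ‖β‖ = ‖b‖ := by
    have := congrArg norm hβ
    rw [norm_mul, norm_mul, hz1, hu1] at this
    linarith
  have hlow : ∀ v : ℂ, v.re ≤ ‖u * v‖ := fun v => by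
    rw [norm_mul, hu1, one_mul]; exact Complex.re_le_norm v
  by_cases hi : β.im = 0
  · obtain ⟨c, s, hcs, hlt⟩ := exists_rotation_lt (p := ‖a‖ - ‖d‖) (q := 2 * β.re)
      (r := ‖a‖ + ‖d‖) (by
        have : ‖β‖ ^ 2 = β.re ^ 2 := by
          rw [Complex.sq_norm, Complex.normSq_apply, hi]; ring
        rw [hbn] at this
        nlinarith)
    refine ⟨c, s, z, hcs, hz1, hlt.trans_le (le_trans (le_trans ?_ (hlow
      ((c ^ 2 - s ^ 2) * (‖a‖ - ‖d‖) + 2 * c * s * (2 * β)))) (le_of_eq_of_le ?_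
        (norm_sub_le _ _)))⟩
    · apply le_of_eq
      simp [← Complex.ofReal_pow, ← Complex.ofReal_sub, ← Complex.ofReal_mul]
    · congr 1
      linear_combination (-(c : ℂ) ^ 2 + s ^ 2) * ha + (c ^ 2 - s ^ 2 : ℂ) * hd - 4 * c * s * hβ
  · obtain ⟨c, s, hcs, hlt⟩ := exists_rotation_lt (p := ‖a‖ + ‖d‖) (q := -2 * β.im)
      (r := ‖a‖ + ‖d‖) (by
        have : 0 < β.im ^ 2 := by positivity
        nlinarith)
    refine ⟨c, s, Complex.I * z, hcs, by simp [hz1], hlt.trans_le (le_trans (le_trans ?_ (hlow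
      ((c ^ 2 - s ^ 2) * (‖a‖ + ‖d‖) + 2 * c * s * (2 * (Complex.I * β))))) (le_of_eq_of_le ?_
        (norm_sub_le _ _)))⟩
    · apply le_of_eq
      simp [← Complex.ofReal_pow, ← Complex.ofReal_sub, ← Complex.ofReal_mul,
        ← Complex.ofReal_add]
    · congr 1
      rw [mul_pow, Complex.I_sq]
      linear_combination (-(c : ℂ) ^ 2 + s ^ 2) * ha - (c ^ 2 - s ^ 2 : ℂ) * hd
        - 4 * c * s * Complex.I * hβ

theorem sum_sum_norm_sq_eq_re_trace {ι : Type*} [Fintype ι] (φ : ι → Fin 2 × Fin 2 → ℂ) :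
    ∑ i, ∑ x, ‖φ i x‖ ^ 2 = (∑ i, pureDM (φ i)).trace.re := by
  rw [Matrix.trace_sum]
  simp only [Complex.re_sum, Matrix.trace, Matrix.diag, pureDM,
    Complex.mul_conj, Complex.ofReal_re, Complex.sq_norm]

theorem norm_spinFlipForm_sq (φ χ : Fin 2 × Fin 2 → ℂ) :
    ((‖spinFlipForm φ χ‖ ^ 2 : ℝ) : ℂ) =
      ∑ x : Fin 2 × Fin 2, ∑ y : Fin 2 × Fin 2,
        (-1) ^ (x.1 + x.2 + y.1 + y.2 : ℕ) * pureDM φ x y *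
          pureDM χ (1 - x.1, 1 - x.2) (1 - y.1, 1 - y.2) := by
  rw [Complex.sq_norm, ← Complex.mul_conj]
  simp only [spinFlipForm, pureDM, Fintype.sum_prod_type, Fin.sum_univ_two, map_sub, map_add,
    map_mul, Fin.val_zero, Fin.val_one, sub_self, sub_zero]
  ring

/-- The Frobenius norm of the matrix of the spin-flip form depends only on the mixed state. -/
theorem sum_norm_spinFlipForm_sq_congr {ι : Type*} [Fintype ι] {φ χ : ι → Fin 2 × Fin 2 → ℂ}
    (h : ∑ i, pureDM (φ i) = ∑ i, pureDM (χ i)) :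
    ∑ i, ∑ j, ‖spinFlipForm (φ i) (φ j)‖ ^ 2 = ∑ i, ∑ j, ‖spinFlipForm (χ i) (χ j)‖ ^ 2 := by
  have key : ∀ ξ : ι → Fin 2 × Fin 2 → ℂ,
      ((∑ i, ∑ j, ‖spinFlipForm (ξ i) (ξ j)‖ ^ 2 : ℝ) : ℂ) =
        ∑ x : Fin 2 × Fin 2, ∑ y : Fin 2 × Fin 2,
          (-1) ^ (x.1 + x.2 + y.1 + y.2 : ℕ) * (∑ i, pureDM (ξ i)) x y *
            (∑ i, pureDM (ξ i)) (1 - x.1, 1 - x.2) (1 - y.1, 1 - y.2) := by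
    intro ξ
    simp only [Complex.ofReal_sum, norm_spinFlipForm_sq, Matrix.sum_apply]
    simp_rw [mul_assoc, Finset.sum_mul_sum, Finset.mul_sum]
    have swap : ∀ F : ι → ι → (Fin 2 × Fin 2) → (Fin 2 × Fin 2) → ℂ,
        ∑ i, ∑ j, ∑ x, ∑ y, F i j x y = ∑ x, ∑ y, ∑ i, ∑ j, F i j x y := by
      intro F
      calc ∑ i, ∑ j, ∑ x, ∑ y, F i j x y = ∑ i, ∑ x, ∑ j, ∑ y, F i j x y :=
            Finset.sum_congr rfl fun i _ => Finset.sum_comm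
        _ = ∑ x, ∑ i, ∑ j, ∑ y, F i j x y := Finset.sum_comm
        _ = ∑ x, ∑ i, ∑ y, ∑ j, F i j x y :=
            Finset.sum_congr rfl fun x _ => Finset.sum_congr rfl fun i _ => Finset.sum_comm
        _ = ∑ x, ∑ y, ∑ i, ∑ j, F i j x y :=
            Finset.sum_congr rfl fun x _ => Finset.sum_comm
    exact swap _
  have := (key φ).trans ((h ▸ rfl : _ = _).trans (key χ).symm)
  exact_mod_cast this

theorem exists_maximal_decomposition {ι : Type*} [Fintype ι] (φ : ι → Fin 2 × Fin 2 → ℂ)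
    (hφ : ∑ i, ∑ x, ‖φ i x‖ ^ 2 = 1) :
    ∃ χ : ι → Fin 2 × Fin 2 → ℂ, ∑ i, pureDM (χ i) = ∑ i, pureDM (φ i) ∧
      ∀ ξ : ι → Fin 2 × Fin 2 → ℂ, ∑ i, pureDM (ξ i) = ∑ i, pureDM (φ i) →
        ∑ i, ‖spinFlipForm (ξ i) (ξ i)‖ ≤ ∑ i, ‖spinFlipForm (χ i) (χ i)‖ := by
  let K : Set (ι → Fin 2 × Fin 2 → ℂ) := {χ | ∑ i, pureDM (χ i) = ∑ i, pureDM (φ i)}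
  have hclosed : IsClosed K := by
    refine isClosed_eq ?_ continuous_const
    refine continuous_finsetSum _ fun i _ => continuous_matrix fun x y => ?_
    unfold pureDM
    fun_prop
  have hbdd : Bornology.IsBounded K := by
    refine (Metric.isBounded_closedBall (x := 0) (r := 1)).subset fun χ hχ => ?_
    rw [mem_closedBall_zero_iff, pi_norm_le_iff_of_nonneg zero_le_one]
    intro i
    rw [pi_norm_le_iff_of_nonneg zero_le_one]
    intro x
    have h1 : ∑ i, ∑ x, ‖χ i x‖ ^ 2 = 1 := by
      rw [sum_sum_norm_sq_eq_re_trace, (hχ : _ = _), ← sum_sum_norm_sq_eq_re_trace, hφ]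
    have h2 : ‖χ i x‖ ^ 2 ≤ 1 := by
      rw [← h1]
      exact (Finset.single_le_sum (f := fun x => ‖χ i x‖ ^ 2) (fun _ _ => by positivity)
        (Finset.mem_univ x)).trans (Finset.single_le_sum (f := fun i => ∑ x, ‖χ i x‖ ^ 2)
          (fun _ _ => by positivity) (Finset.mem_univ i))
    exact (sq_le_one_iff₀ (norm_nonneg _)).1 h2
  obtain ⟨χ, hχ, hmax⟩ := (Metric.isCompact_of_isClosed_isBounded hclosed hbdd).exists_isMaxOn
    ⟨φ, rfl⟩ (f := fun χ => ∑ i, ‖spinFlipForm (χ i) (χ i)‖)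
    (by unfold spinFlipForm; fun_prop)
  exact ⟨χ, hχ, fun ξ hξ => hmax hξ⟩

theorem pureDM_rotate {d : Type*} (φ χ : d → ℂ) {c s : ℝ} {z : ℂ} (hcs : c ^ 2 + s ^ 2 = 1)
    (hz : ‖z‖ = 1) :
    pureDM (fun x => c * φ x + s * z * χ x) + pureDM (fun x => s * φ x - c * z * χ x) =
      pureDM φ + pureDM χ := by
  have hcs' : (c : ℂ) ^ 2 + (s : ℂ) ^ 2 = 1 := by exact_mod_cast hcs
  have hz' : z * (starRingEnd ℂ) z = 1 := by
    rw [Complex.mul_conj, Complex.normSq_eq_norm_sq, hz]; simp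
  ext x y
  simp only [pureDM, Matrix.add_apply, map_add, map_sub, map_mul, Complex.conj_ofReal]
  linear_combination (φ x * (starRingEnd ℂ) (φ y) + z * (starRingEnd ℂ) z *
    χ x * (starRingEnd ℂ) (χ y)) * hcs' + χ x * (starRingEnd ℂ) (χ y) * hz'

theorem norm_spinFlipForm_sq_le_of_maximal {ι : Type*} [Fintype ι]
    {χ : ι → Fin 2 × Fin 2 → ℂ}
    (hmax : ∀ ξ : ι → Fin 2 × Fin 2 → ℂ, ∑ i, pureDM (ξ i) = ∑ i, pureDM (χ i) →
      ∑ i, ‖spinFlipForm (ξ i) (ξ i)‖ ≤ ∑ i, ‖spinFlipForm (χ i) (χ i)‖) (i j : ι) :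
    ‖spinFlipForm (χ i) (χ j)‖ ^ 2 ≤
      ‖spinFlipForm (χ i) (χ i)‖ * ‖spinFlipForm (χ j) (χ j)‖ := by
  classical
  rcases eq_or_ne i j with rfl | hij
  · rw [sq]
  by_contra! hlt
  obtain ⟨c, s, z, hcs, hz, hgt⟩ := exists_congruence_lt hlt
  let ξ : ι → Fin 2 × Fin 2 → ℂ := fun k =>
    if k = i then fun x => c * χ i x + s * z * χ j x
    else if k = j then fun x => s * χ i x - c * z * χ j x else χ k
  have hξi : ξ i = fun x => c * χ i x + s * z * χ j x := by simp [ξ]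
  have hξj : ξ j = fun x => s * χ i x - c * z * χ j x := by simp [ξ, hij.symm]
  have hξ : ∀ k ∈ ((Finset.univ.erase i).erase j), ξ k = χ k := fun k hk => by
    have h1 := Finset.ne_of_mem_erase hk
    have h2 := Finset.ne_of_mem_erase (Finset.mem_of_mem_erase hk)
    simp [ξ, h1, h2]
  have hj : j ∈ Finset.univ.erase i := by simp [hij.symm]
  have hle := hmax ξ (by
    rw [← Finset.add_sum_erase _ _ (Finset.mem_univ i), ← Finset.add_sum_erase _ _ hj,
      ← Finset.add_sum_erase _ (fun k => pureDM (χ k)) (Finset.mem_univ i),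
      ← Finset.add_sum_erase _ (fun k => pureDM (χ k)) hj,
      Finset.sum_congr rfl fun k hk => congrArg pureDM (hξ k hk), ← add_assoc, ← add_assoc,
      hξi, hξj, pureDM_rotate _ _ hcs hz])
  rw [← Finset.add_sum_erase _ _ (Finset.mem_univ i), ← Finset.add_sum_erase _ _ hj,
    ← Finset.add_sum_erase _ (fun k => ‖spinFlipForm (χ k) (χ k)‖) (Finset.mem_univ i),
    ← Finset.add_sum_erase _ (fun k => ‖spinFlipForm (χ k) (χ k)‖) hj,
    Finset.sum_congr rfl fun k hk => by rw [hξ k hk], ← add_assoc, ← add_assoc,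
    add_le_add_iff_right, hξi, hξj] at hle
  refine absurd hle (not_le.2 (hgt.trans_eq ?_))
  congr 2 <;> · simp only [spinFlipForm]; ring

/-- The concurrence of assistance dominates the Frobenius norm of the spin-flip form. -/
theorem sum_norm_spinFlipForm_sq_le_concA_sq {ι : Type*} [Fintype ι]
    (φ : ι → Fin 2 × Fin 2 → ℂ) (hφ : ∑ i, ∑ x, ‖φ i x‖ ^ 2 = 1) :
    ∑ i, ∑ j, ‖spinFlipForm (φ i) (φ j)‖ ^ 2 ≤ concA (∑ i, pureDM (φ i)) ^ 2 := by
  obtain ⟨χ, hχ, hmax⟩ := exists_maximal_decomposition φ hφ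
  rw [← hχ] at hmax ⊢
  rw [← sum_norm_spinFlipForm_sq_congr hχ]
  calc ∑ i, ∑ j, ‖spinFlipForm (χ i) (χ j)‖ ^ 2
      ≤ ∑ i, ∑ j, ‖spinFlipForm (χ i) (χ i)‖ * ‖spinFlipForm (χ j) (χ j)‖ :=
        Finset.sum_le_sum fun i _ => Finset.sum_le_sum fun j _ =>
          norm_spinFlipForm_sq_le_of_maximal hmax i j
    _ = (∑ i, ‖spinFlipForm (χ i) (χ i)‖) ^ 2 := by rw [sq, Finset.sum_mul_sum]
    _ ≤ concA (∑ i, pureDM (χ i)) ^ 2 := by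
        refine pow_le_pow_left₀ (by positivity) (sum_norm_spinFlipForm_le_concA χ ?_) 2
        rw [sum_sum_norm_sq_eq_re_trace, hχ, ← sum_sum_norm_sq_eq_re_trace, hφ]

/-- Exchange the coordinates in `T` between two copies of a configuration. -/
def swapOn {ι α : Type*} [DecidableEq ι] (T : Finset ι) (p : (ι → α) × (ι → α)) :
    (ι → α) × (ι → α) :=
  (T.piecewise p.2 p.1, T.piecewise p.1 p.2)

section SwapOn

variable {ι α : Type*} [DecidableEq ι]

theorem swapOn_swapOn (S T : Finset ι) (p : (ι → α) × (ι → α)) :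
    swapOn S (swapOn T p) = swapOn (symmDiff S T) p := by
  ext i <;> by_cases hS : i ∈ S <;> by_cases hT : i ∈ T <;>
    simp [swapOn, Finset.piecewise, Finset.mem_symmDiff, hS, hT]

theorem swapOn_comm (S T : Finset ι) (p : (ι → α) × (ι → α)) :
    swapOn S (swapOn T p) = swapOn T (swapOn S p) := by
  rw [swapOn_swapOn, swapOn_swapOn, symmDiff_comm]

theorem swapOn_empty (p : (ι → α) × (ι → α)) : swapOn ∅ p = p := by
  simp [swapOn]

theorem swapOn_involutive (T : Finset ι) :
    Function.Involutive (swapOn T : (ι → α) × (ι → α) → (ι → α) × (ι → α)) := fun p => by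
  rw [swapOn_swapOn, symmDiff_self, Finset.bot_eq_empty, swapOn_empty]

variable [Fintype ι] [Fintype α]

/-- The squared norm of the part of `w` that changes under `swapOn T`. -/
def swapDefect (T : Finset ι) (w : (ι → α) × (ι → α) → ℂ) : ℝ :=
  ∑ p, ‖w p - w (swapOn T p)‖ ^ 2

theorem sum_comp_swapOn (T : Finset ι) (f : (ι → α) × (ι → α) → ℝ) :
    ∑ p, f (swapOn T p) = ∑ p, f p :=
  Equiv.sum_comp (swapOn_involutive T).toPerm f

theorem swapDefect_symmDiff_le (S T : Finset ι) (w : (ι → α) × (ι → α) → ℂ) :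
    swapDefect (symmDiff S T) w ≤ swapDefect S w + swapDefect T w := by
  have hpt : ∀ a b c d : ℂ, ‖a - d‖ ^ 2 + ‖b - c‖ ^ 2 ≤
      ‖a - b‖ ^ 2 + ‖c - d‖ ^ 2 + (‖a - c‖ ^ 2 + ‖b - d‖ ^ 2) := by
    intro a b c d
    simp only [Complex.sq_norm, Complex.normSq_apply, Complex.sub_re, Complex.sub_im]
    nlinarith [sq_nonneg (a.re - b.re - c.re + d.re), sq_nonneg (a.im - b.im - c.im + d.im)]
  have h1 : ∑ p, ‖w (swapOn S p) - w (swapOn T p)‖ ^ 2 = swapDefect (symmDiff S T) w := by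
    rw [← sum_comp_swapOn S]
    refine Finset.sum_congr rfl fun p _ => ?_
    rw [swapOn_involutive S p, swapOn_comm, swapOn_swapOn]
  have h2 : ∑ p, ‖w (swapOn T p) - w (swapOn (symmDiff S T) p)‖ ^ 2 = swapDefect S w := by
    simp only [← swapOn_swapOn]
    exact sum_comp_swapOn T (fun p => ‖w p - w (swapOn S p)‖ ^ 2)
  have h3 : ∑ p, ‖w (swapOn S p) - w (swapOn (symmDiff S T) p)‖ ^ 2 = swapDefect T w := by
    simp only [symmDiff_comm S T, ← swapOn_swapOn]
    exact sum_comp_swapOn S (fun p => ‖w p - w (swapOn T p)‖ ^ 2)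
  have h4 := Finset.sum_le_sum fun p (_ : p ∈ Finset.univ) =>
    hpt (w p) (w (swapOn S p)) (w (swapOn T p)) (w (swapOn (symmDiff S T) p))
  simp only [Finset.sum_add_distrib, h1, h2, h3] at h4
  change swapDefect _ w + _ ≤ swapDefect S w + _ + (swapDefect T w + _) at h4
  linarith

theorem swapDefect_le_sum (T : Finset ι) (w : (ι → α) × (ι → α) → ℂ) :
    swapDefect T w ≤ ∑ u ∈ T, swapDefect {u} w := by
  induction T using Finset.induction_on with
  | empty => simp [swapDefect, swapOn_empty]
  | insert u T hu ih =>
    have h : insert u T = symmDiff {u} T := by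
      ext i
      simp only [Finset.mem_insert, Finset.mem_symmDiff, Finset.mem_singleton]
      by_cases hi : i = u
      · simp [hi, hu]
      · simp [hi]
    rw [Finset.sum_insert hu]
    conv_lhs => rw [h]
    exact (swapDefect_symmDiff_le _ _ _).trans (by gcongr)

theorem swapDefect_sub_comm (S T : Finset ι) (w : (ι → α) × (ι → α) → ℂ) :
    swapDefect S (fun p => w p - w (swapOn T p)) =
      swapDefect T (fun p => w p - w (swapOn S p)) := by
  refine Finset.sum_congr rfl fun p _ => ?_
  dsimp only
  rw [swapOn_comm S T]
  congr 2
  ring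

/-- For a function invariant under the full exchange, the defect of a cut is bounded by the sum
over all pairs of sites across the cut. -/
theorem four_mul_swapDefect_le (T : Finset ι) (w : (ι → α) × (ι → α) → ℂ)
    (hw : ∀ p, w (p.2, p.1) = w p) :
    4 * swapDefect T w ≤
      ∑ j ∈ Tᶜ, ∑ u ∈ T, swapDefect {u} (fun p => w p - w (swapOn {j} p)) := by
  have hc : ∀ p, w (swapOn Tᶜ p) = w (swapOn T p) := fun p => by
    rw [← hw (swapOn T p)]
    congr 1
    ext i <;> by_cases hi : i ∈ T <;> simp [swapOn, hi]
  have h1 : swapDefect Tᶜ (fun p => w p - w (swapOn T p)) = 4 * swapDefect T w := by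
    rw [swapDefect, swapDefect, Finset.mul_sum]
    refine Finset.sum_congr rfl fun p _ => ?_
    rw [← hc (swapOn Tᶜ p), swapOn_involutive, hc]
    have : w p - w (swapOn T p) - (w (swapOn T p) - w p) = 2 * (w p - w (swapOn T p)) := by ring
    rw [this, norm_mul, mul_pow, Complex.norm_ofNat]
    norm_num
  rw [← h1]
  refine (swapDefect_le_sum _ _).trans (Finset.sum_le_sum fun j _ => ?_)
  rw [swapDefect_sub_comm]
  exact swapDefect_le_sum _ _

end SwapOn

/-- Splitting a configuration into two sites and the rest. -/
def assemble2Equiv {N : ℕ} {u v : Fin N} (huv : u ≠ v) :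
    (Fin 2 × Fin 2) × ({i : Fin N // i ≠ u ∧ i ≠ v} → Fin 2) ≃ (Fin N → Fin 2) where
  toFun q := assemble2 u v q.1.1 q.1.2 q.2
  invFun x := ((x u, x v), fun i => x i)
  left_inv q := by
    refine Prod.ext (Prod.ext ?_ ?_) (funext fun i => ?_)
    · simp [assemble2]
    · simp [assemble2, huv.symm]
    · simp [assemble2, i.2.1, i.2.2]
  right_inv x := by
    ext i
    simp only [assemble2]
    split_ifs with h h' <;> simp [*]

theorem swapOn_left_assemble2 {N : ℕ} {u v : Fin N} (a b a₂ b₂ : Fin 2)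
    (f g : {i : Fin N // i ≠ u ∧ i ≠ v} → Fin 2) :
    swapOn {u} (assemble2 u v a b f, assemble2 u v a₂ b₂ g) =
      (assemble2 u v a₂ b f, assemble2 u v a b₂ g) := by
  refine Prod.ext (funext fun i => ?_) (funext fun i => ?_) <;> by_cases hi : i = u <;>
    simp [swapOn, assemble2, Finset.piecewise, hi]

theorem swapOn_right_assemble2 {N : ℕ} {u v : Fin N} (huv : u ≠ v) (a b a₂ b₂ : Fin 2)
    (f g : {i : Fin N // i ≠ u ∧ i ≠ v} → Fin 2) :
    swapOn {v} (assemble2 u v a b f, assemble2 u v a₂ b₂ g) =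
      (assemble2 u v a b₂ f, assemble2 u v a₂ b g) := by
  refine Prod.ext (funext fun i => ?_) (funext fun i => ?_) <;> by_cases hi : i = v <;>
    simp [swapOn, assemble2, Finset.piecewise, hi, huv.symm]

theorem sum_swap_swap_norm_sq (φ χ : Fin 2 × Fin 2 → ℂ) :
    ∑ x : Fin 2 × Fin 2, ∑ y : Fin 2 × Fin 2,
      ‖φ x * χ y - φ (x.1, y.2) * χ (y.1, x.2) -
        (φ (y.1, x.2) * χ (x.1, y.2) - φ y * χ x)‖ ^ 2 = 4 * ‖spinFlipForm φ χ‖ ^ 2 := by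
  have h2 : ∀ z : ℂ, ‖z‖ ^ 2 = z.re ^ 2 + z.im ^ 2 := fun z => by
    rw [Complex.sq_norm, Complex.normSq_apply]; ring
  simp only [spinFlipForm, Fintype.sum_prod_type, Fin.sum_univ_two, h2, Complex.sub_re,
    Complex.sub_im, Complex.add_re, Complex.add_im]
  ring

theorem swapDefect_pair_le_concA_sq {N : ℕ} {u v : Fin N} (huv : u ≠ v)
    (ψ : (Fin N → Fin 2) → ℂ) (hψ : ∑ x, ‖ψ x‖ ^ 2 = 1) :
    swapDefect {u} (fun p => ψ p.1 * ψ p.2 - ψ (swapOn {v} p).1 * ψ (swapOn {v} p).2) ≤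
      4 * concA (rdm2 u v ψ) ^ 2 := by
  let φ : ({i : Fin N // i ≠ u ∧ i ≠ v} → Fin 2) → Fin 2 × Fin 2 → ℂ :=
    fun f x => ψ (assemble2 u v x.1 x.2 f)
  have hρ : rdm2 u v ψ = ∑ f, pureDM (φ f) := by
    ext x y
    simp [rdm2, Matrix.sum_apply, pureDM, φ]
  have hφ : ∑ f, ∑ x, ‖φ f x‖ ^ 2 = 1 := by
    rw [Finset.sum_comm, ← Fintype.sum_prod_type', ← hψ]
    exact Equiv.sum_comp (assemble2Equiv huv) (fun x => ‖ψ x‖ ^ 2)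
  rw [hρ]
  refine le_trans (le_of_eq ?_)
    (mul_le_mul_of_nonneg_left (sum_norm_spinFlipForm_sq_le_concA_sq φ hφ) zero_le_four)
  rw [swapDefect, ← Equiv.sum_comp ((assemble2Equiv huv).prodCongr (assemble2Equiv huv))]
  simp only [Fintype.sum_prod_type (α₂ := (Fin 2 × Fin 2) × _)]
  simp only [Fintype.sum_prod_type (α₁ := Fin 2 × Fin 2)]
  rw [Finset.sum_comm, Finset.mul_sum]
  refine Finset.sum_congr rfl fun f _ => ?_
  rw [Finset.sum_congr rfl fun x _ => Finset.sum_comm, Finset.sum_comm, Finset.mul_sum]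
  refine Finset.sum_congr rfl fun g _ => ?_
  rw [← sum_swap_swap_norm_sq]
  refine Finset.sum_congr rfl fun x _ => Finset.sum_congr rfl fun y _ => ?_
  simp only [Equiv.prodCongr_apply, Prod.map, assemble2Equiv, Equiv.coe_fn_mk,
    swapOn_left_assemble2, swapOn_right_assemble2 huv, φ]

theorem qubitCut_sq_eq_swapDefect {N : ℕ} (P : Fin N → Prop) [DecidablePred P]
    (ψ : (Fin N → Fin 2) → ℂ) (hψ : ∑ x, ‖ψ x‖ ^ 2 = 1) :
    qubitCut P ψ ^ 2 = swapDefect (Finset.univ.filter P) (fun p => ψ p.1 * ψ p.2) := by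
  let e := Equiv.piEquivPiSubtypeProd P (fun _ : Fin N => Fin 2)
  have h1 : ∑ x, ‖ψ (e.symm x)‖ ^ 2 = 1 := by
    rw [← hψ]
    exact Equiv.sum_comp e.symm (fun x => ‖ψ x‖ ^ 2)
  have h2 := two_mul_one_sub_trSq (fun x => ψ (e.symm x)) h1
  rw [qubitCut, pureConc, Real.sq_sqrt (h2 ▸ by positivity)]
  refine h2.trans ?_
  rw [swapDefect, ← Equiv.sum_comp (e.symm.prodCongr e.symm)]
  refine Finset.sum_congr rfl fun p _ => ?_
  have h3 : swapOn (Finset.univ.filter P) ((e.symm.prodCongr e.symm) p) =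
      (e.symm (p.2.1, p.1.2), e.symm (p.1.1, p.2.2)) := by
    refine Prod.ext (funext fun i => ?_) (funext fun i => ?_) <;> by_cases hi : P i <;>
      simp [swapOn, Finset.piecewise, e, Equiv.piEquivPiSubtypeProd, hi]
  rw [h3, mul_comm (ψ (e.symm (p.2.1, p.1.2)))]
  rfl

/-- The squared concurrence across a cut is at most the sum of the squared concurrences of
assistance over all pairs of qubits across the cut. -/
theorem qubitCut_sq_le_sum {N : ℕ} (P : Fin N → Prop) [DecidablePred P]
    (ψ : (Fin N → Fin 2) → ℂ) (hψ : ∑ x, ‖ψ x‖ ^ 2 = 1) :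
    qubitCut P ψ ^ 2 ≤
      ∑ j ∈ (Finset.univ.filter P)ᶜ, ∑ u ∈ Finset.univ.filter P, concA (rdm2 u j ψ) ^ 2 := by
  have h := four_mul_swapDefect_le (Finset.univ.filter P)
    (fun p : (Fin N → Fin 2) × (Fin N → Fin 2) => ψ p.1 * ψ p.2) (fun p => mul_comm _ _)
  rw [← qubitCut_sq_eq_swapDefect P ψ hψ] at h
  refine le_of_mul_le_mul_left (h.trans ?_) (zero_lt_four (α := ℝ))
  simp only [Finset.mul_sum]
  refine Finset.sum_le_sum fun j hj => Finset.sum_le_sum fun u hu => ?_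
  refine swapDefect_pair_le_concA_sq ?_ ψ hψ
  rintro rfl
  exact (Finset.mem_compl.1 hj) hu

/-- Corollary 2 of the paper (upper bound) for the concurrence across the cut
`ABC₁ | C₂…C_{N-2}`.  Qubits: `A = 0`, `B = 1`, `C₁ = 2`, `C_i = i + 1`. -/
theorem corollary2_upper_bound
    (N : ℕ) (hN : 4 ≤ N) (ψ : (Fin N → Fin 2) → ℂ)
    (hψ : ∑ x, ‖ψ x‖ ^ 2 = 1) :
    (qubitCut (fun i : Fin N => (i : ℕ) < 3) ψ) ^ 2 ≤
      2 * (concA (rdm2 (⟨0, by omega⟩ : Fin N) (⟨1, by omega⟩ : Fin N) ψ)) ^ 2 +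
        (∑ i : Fin (N - 2),
          ((concA (rdm2 (⟨0, by omega⟩ : Fin N) (⟨(i : ℕ) + 2, by have := i.isLt; omega⟩ : Fin N) ψ)) ^ 2 + (concA (rdm2 (⟨1, by omega⟩ : Fin N) (⟨(i : ℕ) + 2, by have := i.isLt; omega⟩ : Fin N) ψ)) ^ 2)) +
        ∑ j ∈ Finset.univ \ {(⟨2, by omega⟩ : Fin N)}, (concA (rdm2 (⟨2, by omega⟩ : Fin N) j ψ)) ^ 2 := by
  refine (qubitCut_sq_le_sum _ ψ hψ).trans ?_
  set T := Finset.univ.filter (fun i : Fin N => (i : ℕ) < 3) with hT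
  have hT3 : T = {(⟨0, by omega⟩ : Fin N), ⟨1, by omega⟩, ⟨2, by omega⟩} := by
    ext i
    simp only [hT, Finset.mem_filter_univ, Finset.mem_insert, Finset.mem_singleton, Fin.ext_iff]
    omega
  have hsum : ∀ g : Fin N → ℝ, (∀ j, 0 ≤ g j) →
      ∑ j ∈ Tᶜ, g j ≤ ∑ i : Fin (N - 2), g ⟨(i : ℕ) + 2, by have := i.isLt; omega⟩ := by
    intro g hg
    let e : Fin (N - 2) ↪ Fin N := ⟨fun i => ⟨(i : ℕ) + 2, by have := i.isLt; omega⟩,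
      fun i k hik => by simpa [Fin.ext_iff] using hik⟩
    have he := Finset.sum_map Finset.univ e g
    refine le_trans (Finset.sum_le_sum_of_subset_of_nonneg ?_ fun j _ _ => hg j) he.le
    intro j hj
    have hj3 : 3 ≤ (j : ℕ) := by simpa [hT] using hj
    exact Finset.mem_map.2 ⟨⟨(j : ℕ) - 2, by have := j.isLt; omega⟩, Finset.mem_univ _,
      Fin.ext (Nat.sub_add_cancel (by omega))⟩
  have hlast : ∀ g : Fin N → ℝ, (∀ j, 0 ≤ g j) →
      ∑ j ∈ Tᶜ, g j ≤ ∑ j ∈ Finset.univ \ {(⟨2, by omega⟩ : Fin N)}, g j := by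
    intro g hg
    refine Finset.sum_le_sum_of_subset_of_nonneg (fun j hj => ?_) fun j _ _ => hg j
    have hj3 : 3 ≤ (j : ℕ) := by simpa [hT] using hj
    simp only [Finset.mem_sdiff, Finset.mem_univ, Finset.mem_singleton, Fin.ext_iff, true_and]
    omega
  have hsplit : ∀ j, ∑ u ∈ T, concA (rdm2 u j ψ) ^ 2 =
      concA (rdm2 ⟨0, by omega⟩ j ψ) ^ 2 + (concA (rdm2 ⟨1, by omega⟩ j ψ) ^ 2 +
        concA (rdm2 ⟨2, by omega⟩ j ψ) ^ 2) := by
    intro j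
    rw [hT3, Finset.sum_insert (by simp), Finset.sum_insert (by simp), Finset.sum_singleton]
  simp only [hsplit, Finset.sum_add_distrib]
  have hA := hsum (fun j => concA (rdm2 ⟨0, by omega⟩ j ψ) ^ 2) fun _ => sq_nonneg _
  have hB := hsum (fun j => concA (rdm2 ⟨1, by omega⟩ j ψ) ^ 2) fun _ => sq_nonneg _
  have hC := hlast (fun j => concA (rdm2 ⟨2, by omega⟩ j ψ) ^ 2) fun _ => sq_nonneg _
  have hAB := sq_nonneg (concA (rdm2 (⟨0, by omega⟩ : Fin N) ⟨1, by omega⟩ ψ))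
  simp only at hA hB hC
  linarith

end
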